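/- Let p > 2 be a prime, let K be a finite extension of ℚ_p, and let d ≥ 1 be an integer. Then there exists a finite Galois extension L of K inside K̄, depending only on K, p and d, such that for every continuous representation ρ : Gal(K̄/K) → GL_d(ℤ_p), the subgroup Gal(K̄/L) acts trivially on T/12pT; that is, the composite of ρ with the reduction homomorphism GL_d(ℤ_p) → GL_d(ℤ_p/12pℤ_p) sends every element of Gal(K̄/L) to the identity. -/

import Mathlib

open Topology Polynomial IntermediateField

theorem aux_local {k C : Type*} [NontriviallyNormedField k] [NormedField C] [NormedAlgebra k C]
    [IsAlgClosed C] [IsGalois k C] (hiso : ∀ (σ : C ≃ₐ[k] C) (x : C), ‖σ x‖ = ‖x‖)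
    (E : IntermediateField k C) (n : ℕ) (hn : 1 ≤ n) (r : ℝ) (hr : 0 < r) (v : Fin n → E) :
    ∃ U ∈ 𝓝 v, ∃ B : Set C, B.Finite ∧ (∀ b ∈ B, b ∉ E) ∧
      ∀ α : C, (minpoly E α).natDegree = n → (fun i : Fin n => (minpoly E α).coeff i) ∈ U →
        (∀ b ∈ E, r ≤ ‖α - b‖) → ∃ b ∈ B, b ∈ E⟮α⟯ := by
  have hisoE : ∀ (σ : C ≃ₐ[E] C) (x : C), ‖σ x‖ = ‖x‖ := fun σ x => hiso (σ.restrictScalars k) x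
  have hint : ∀ x : C, IsIntegral E x := fun x =>
    ((Algebra.IsAlgebraic.isAlgebraic (R := k) x).isIntegral).tower_top
  obtain ⟨β, hβ⟩ : ∃ β : C, β ^ n + ∑ i : Fin n, (v i : C) * β ^ (i : ℕ) = 0 := by
    have hd : (X ^ n + ∑ i : Fin n, Polynomial.C (v i : C) * X ^ (i : ℕ)).degree = n :=
      by
        rw [degree_add_eq_left_of_degree_lt] <;> rw [degree_X_pow]
        exact degree_sum_fin_lt _
    obtain ⟨β, hβ⟩ := IsAlgClosed.exists_root
      (X ^ n + ∑ i : Fin n, Polynomial.C (v i : C) * X ^ (i : ℕ)) (by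
        rw [hd]; exact_mod_cast (by omega))
    refine ⟨β, ?_⟩
    simpa [IsRoot, eval_finsetSum] using hβ
  have hfin : ((minpoly E β).rootSet C).Finite := rootSet_finite _ _
  have hmem : ∀ σ : C ≃ₐ[E] C, σ β ∈ (minpoly E β).rootSet C := by
    intro σ
    rw [mem_rootSet]
    refine ⟨minpoly.ne_zero (hint β), ?_⟩
    have := aeval_algHom_apply σ.toAlgHom β (minpoly E β)
    simpa using this
  obtain ⟨ε, hε, hεr, hK⟩ : ∃ ε : ℝ, 0 < ε ∧ ε ≤ r ∧
      ∀ σ : C ≃ₐ[E] C, ‖σ β - β‖ < 2 * ε → σ β = β := by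
    have h1 : ((minpoly E β).rootSet C \ {β})ᶜ ∈ 𝓝 β :=
      (hfin.subset Set.sdiff_subset).isClosed.isOpen_compl.mem_nhds (by simp)
    obtain ⟨δ, hδ, hball⟩ := Metric.mem_nhds_iff.1 h1
    refine ⟨min r (δ / 2), by positivity, min_le_left _ _, fun σ hσ => ?_⟩
    have h2 : σ β ∈ Metric.ball β δ := by
      rw [Metric.mem_ball, dist_eq_norm]
      have := min_le_right r (δ / 2)
      linarith
    by_contra hne
    exact hball h2 ⟨hmem σ, hne⟩
  refine ⟨{w | ‖β ^ n + ∑ i : Fin n, (w i : C) * β ^ (i : ℕ)‖ < ε ^ n}, ?_,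
    (minpoly E β).rootSet C \ E, hfin.subset Set.sdiff_subset, fun b hb => hb.2, ?_⟩
  · have hc : Continuous fun w : Fin n → E => ‖β ^ n + ∑ i : Fin n, (w i : C) * β ^ (i : ℕ)‖ := by
      fun_prop
    refine (isOpen_lt hc continuous_const).mem_nhds ?_
    simp only [Set.mem_ofPred_eq, hβ, norm_zero]
    positivity
  · intro α hdeg hU hdist
    have hev : aeval β (minpoly E α) = β ^ n +
        ∑ i : Fin n, (((minpoly E α).coeff i : E) : C) * β ^ (i : ℕ) := by
      rw [aeval_eq_sum_range, hdeg, Finset.sum_range_succ, Finset.sum_range, add_comm]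
      have : (minpoly E α).coeff n = 1 := by
        rw [← hdeg]; exact minpoly.monic (hint α)
      rw [this, one_smul]
      rfl
    have hlt : ‖aeval β (minpoly E α)‖ < ε ^ n := by rw [hev]; exact hU
    have hsp : ((minpoly E α).map (algebraMap E C)).Splits := IsAlgClosed.splits _
    obtain ⟨α', hα', hclose⟩ : ∃ α' ∈ (minpoly E α).aroots C, ‖β - α'‖ < ε := by
      by_contra! hcon
      have hprod : aeval β (minpoly E α) = (((minpoly E α).aroots C).map (fun a => β - a)).prod := by
        have h := hsp.eq_prod_roots_of_monic ((minpoly.monic (hint α)).map _)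
        rw [← eval_map_algebraMap, h, eval_multiset_prod]
        simp [Multiset.map_map, aroots]
      have hcard : ((minpoly E α).aroots C).card = n := by
        rw [← hdeg, ← natDegree_map (algebraMap E C)]
        exact hsp.natDegree_eq_card_roots.symm
      have : ε ^ n ≤ ‖aeval β (minpoly E α)‖ := by
        rw [hprod, ← hcard]
        generalize (minpoly E α).aroots C = s at hcon
        clear hprod hcard
        induction s using Multiset.induction_on with
        | empty => simp
        | cons a s ih =>
          rw [Multiset.map_cons, Multiset.prod_cons, norm_mul, Multiset.card_cons, pow_succ']
          have h1 := hcon a (by simp)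
          have h2 := ih (fun x hx => hcon x (by simp [hx]))
          gcongr
      linarith
    have hroot : aeval α' (minpoly E α) = 0 := (mem_aroots.1 hα').2
    obtain ⟨σ, hσ⟩ := minpoly.exists_algEquiv_of_root' (K := E) (L := C) (hint α).isAlgebraic hroot
    have hc2 : ‖σ.symm β - α‖ < ε := by
      rw [← hisoE σ, map_sub, hσ]; simpa using hclose
    refine ⟨σ.symm β, ⟨hmem _, fun hE => ?_⟩, ?_⟩
    · have := hdist _ hE
      rw [norm_sub_rev] at this
      linarith
    · rw [← InfiniteGalois.fixedField_fixingSubgroup (E⟮α⟯), mem_fixedField_iff]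
      intro τ hτ
      have hτα : τ α = α := hτ ⟨α, mem_adjoin_simple_self E α⟩
      have h3 : ‖τ (σ.symm β) - α‖ < ε := by
        rw [← hisoE τ.symm, map_sub]
        have : τ.symm α = α := by rw [AlgEquiv.symm_apply_eq, hτα]
        simpa [this] using hc2
      have h4 := hK ((σ.symm.trans τ).trans σ) (by
        rw [← hisoE σ.symm, map_sub]
        simp only [AlgEquiv.trans_apply, AlgEquiv.symm_apply_apply]
        calc ‖τ (σ.symm β) - σ.symm β‖ = ‖(τ (σ.symm β) - α) - (σ.symm β - α)‖ := by congr 1; ring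
          _ ≤ _ := norm_sub_le _ _
          _ < 2 * ε := by linarith)
      simp only [AlgEquiv.trans_apply] at h4
      rw [AlgEquiv.eq_symm_apply]
      exact h4

theorem aux_compact {k C : Type*} [NontriviallyNormedField k] [ProperSpace k]
    [NormedField C] [NormedAlgebra k C]
    [IsAlgClosed C] [IsGalois k C] (hiso : ∀ (σ : C ≃ₐ[k] C) (x : C), ‖σ x‖ = ‖x‖)
    (E : IntermediateField k C) [FiniteDimensional k E] (n : ℕ) (hn : 1 ≤ n) :
    ∃ B : Set C, B.Finite ∧ (∀ b ∈ B, b ∉ E) ∧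
      ∀ α : C, (minpoly E α).natDegree = n → α ∉ E → ∃ b ∈ B, b ∈ E⟮α⟯ := by
  have hisoE : ∀ (σ : C ≃ₐ[E] C) (x : C), ‖σ x‖ = ‖x‖ := fun σ x => hiso (σ.restrictScalars k) x
  have hint : ∀ x : C, IsIntegral E x := fun x =>
    ((Algebra.IsAlgebraic.isAlgebraic (R := k) x).isIntegral).tower_top
  obtain ⟨c, hc⟩ := NormedField.exists_one_lt_norm k
  have hc0 : 0 < ‖c‖ := by linarith
  let r : ℝ := ‖c‖⁻¹ / 2
  have hr : 0 < r := by positivity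
  have : ProperSpace E := FiniteDimensional.proper k E
  have hcpt : IsCompact (Metric.closedBall (0 : Fin n → E) (2 ^ n)) := isCompact_closedBall _ _
  obtain ⟨B, hBf, hBE, hB⟩ := hcpt.induction_on
    (p := fun U => ∃ B : Set C, B.Finite ∧ (∀ b ∈ B, b ∉ E) ∧
      ∀ α : C, (minpoly E α).natDegree = n → (fun i : Fin n => (minpoly E α).coeff i) ∈ U →
        (∀ b ∈ E, r ≤ ‖α - b‖) → ∃ b ∈ B, b ∈ E⟮α⟯)
    ⟨∅, by simp⟩
    (by
      rintro s t hst ⟨B, h1, h2, h3⟩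
      exact ⟨B, h1, h2, fun α ha hb => h3 α ha (hst hb)⟩)
    (by
      rintro s t ⟨B, h1, h2, h3⟩ ⟨B', h1', h2', h3'⟩
      refine ⟨B ∪ B', h1.union h1', ?_, ?_⟩
      · rintro b (hb | hb)
        exacts [h2 b hb, h2' b hb]
      · rintro α ha (hb | hb) hd
        · obtain ⟨b, hb, hb'⟩ := h3 α ha hb hd
          exact ⟨b, Or.inl hb, hb'⟩
        · obtain ⟨b, hb, hb'⟩ := h3' α ha hb hd
          exact ⟨b, Or.inr hb, hb'⟩)
    (by
      intro v _
      obtain ⟨U, hU, h⟩ := aux_local hiso E n hn r hr v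
      exact ⟨U, mem_nhdsWithin_of_mem_nhds hU, h⟩)
  refine ⟨B, hBf, hBE, fun α hdeg hα => ?_⟩
  have hclosed : IsClosed (E : Set C) :=
    Submodule.closed_of_finiteDimensional (E.toSubalgebra.toSubmodule)
  have hne : (E : Set C).Nonempty := ⟨0, E.zero_mem⟩
  have hpos : 0 < Metric.infDist α E := (hclosed.notMem_iff_infDist_pos hne).1 hα
  obtain ⟨a, ha, hda⟩ := (Metric.infDist_lt_iff hne (r := 2 * Metric.infDist α E)).1 (by linarith)
  rw [dist_eq_norm] at hda
  have hαa : α - a ≠ 0 := fun h => hα (by rw [sub_eq_zero.1 h]; exact ha)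
  obtain ⟨e, he0, he1, he2, -⟩ := rescale_to_shell hc (zero_lt_one) hαa
  have hemem : algebraMap k C e ∈ E := E.algebraMap_mem e
  have he0' : algebraMap k C e ≠ 0 := by simpa using he0
  set α' := e • (α - a) with hα'
  rw [Algebra.smul_def] at hα'
  have hadj : E⟮α'⟯ ≤ E⟮α⟯ := by
    rw [adjoin_simple_le_iff, hα']
    refine mul_mem (E⟮α⟯.algebraMap_mem ⟨_, hemem⟩) (sub_mem (mem_adjoin_simple_self E α)
      (E⟮α⟯.algebraMap_mem ⟨_, ha⟩))
  have hadj' : E⟮α⟯ ≤ E⟮α'⟯ := by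
    rw [adjoin_simple_le_iff]
    have : α = (algebraMap k C e)⁻¹ * α' + a := by rw [hα']; field_simp; ring
    rw [this]
    exact add_mem (mul_mem (E⟮α'⟯.algebraMap_mem ⟨_, inv_mem hemem⟩) (mem_adjoin_simple_self E α'))
      (E⟮α'⟯.algebraMap_mem ⟨_, ha⟩)
  have hdeg' : (minpoly E α').natDegree = n := by
    rw [← hdeg, ← adjoin.finrank (hint α), ← adjoin.finrank (hint α'), le_antisymm hadj hadj']
  have key := hB α' hdeg' ?_ ?_
  · obtain ⟨b, hb, hb'⟩ := key
    exact ⟨b, hb, hadj hb'⟩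
  · rw [mem_closedBall_zero_iff, pi_norm_le_iff_of_nonneg (by positivity)]
    intro i
    have h := coeff_le_of_roots_le (f := algebraMap E C) (B := 1) i (minpoly.monic (hint α'))
      (IsAlgClosed.splits _) (by
        intro z hz
        have hroot : aeval z (minpoly E α') = 0 := (mem_aroots.1 hz).2
        obtain ⟨σ, hσ⟩ := minpoly.exists_algEquiv_of_root' (K := E) (L := C) (hint α').isAlgebraic hroot
        rw [← hσ, hisoE]
        exact he1.le)
    rw [coeff_map, one_pow, one_mul, hdeg'] at h
    refine (le_trans (le_of_eq rfl) h).trans ?_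
    exact_mod_cast Nat.choose_le_two_pow n i
  · intro b hb
    have h1 : Metric.infDist α E ≤ ‖α - (a + (algebraMap k C e)⁻¹ * b)‖ := by
      rw [← dist_eq_norm]
      exact Metric.infDist_le_dist_of_mem (add_mem ha (mul_mem (inv_mem hemem) hb))
    have h2 : α' - b = algebraMap k C e * (α - (a + (algebraMap k C e)⁻¹ * b)) := by
      rw [hα']; field_simp; ring
    rw [h2, norm_mul]
    rw [one_div, hα', norm_mul] at he2
    have h3 : 0 < ‖algebraMap k C e‖ := by simpa using he0
    simp only [r]
    nlinarith

theorem aux_finite {k C : Type*} [NontriviallyNormedField k] [ProperSpace k]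
    [NormedField C] [NormedAlgebra k C]
    [IsAlgClosed C] [IsGalois k C] (hiso : ∀ (σ : C ≃ₐ[k] C) (x : C), ‖σ x‖ = ‖x‖) (N : ℕ) :
    ∀ (m : ℕ) (E : IntermediateField k C) [FiniteDimensional k E], N ≤ Module.finrank k E + m →
    {F : IntermediateField k C | E ≤ F ∧ FiniteDimensional k F ∧ Module.finrank k F ≤ N}.Finite := by
  intro m
  induction m with
  | zero =>
    intro E _ hE
    refine (Set.finite_singleton E).subset ?_
    rintro F ⟨h1, h2, h3⟩
    exact (eq_of_le_of_finrank_le h1 (by omega)).symm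
  | succ m ih =>
    intro E _ hE
    have hint : ∀ x : C, IsIntegral E x := fun x =>
      ((Algebra.IsAlgebraic.isAlgebraic (R := k) x).isIntegral).tower_top
    choose B hBf hBE hB using fun n : ℕ => aux_compact hiso E (n + 1) (by omega)
    have hfin : (⋃ n ∈ Finset.range N, B n).Finite :=
      Set.Finite.biUnion (Finset.finite_toSet _) (fun n _ => hBf n)
    have hfin2 : (⋃ b ∈ (⋃ n ∈ Finset.range N, B n), {F : IntermediateField k C |
        E ⊔ k⟮b⟯ ≤ F ∧ FiniteDimensional k F ∧ Module.finrank k F ≤ N}).Finite := by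
      refine hfin.biUnion fun b hb => ?_
      have hbE : b ∉ E := by
        simp only [Set.mem_iUnion] at hb
        obtain ⟨n, -, hn⟩ := hb
        exact hBE n b hn
      have : FiniteDimensional k k⟮b⟯ :=
        adjoin.finiteDimensional (Algebra.IsAlgebraic.isAlgebraic (R := k) b).isIntegral
      refine ih (E ⊔ k⟮b⟯) ?_
      have : Module.finrank k E < Module.finrank k (E ⊔ k⟮b⟯ : IntermediateField k C) := by
        by_contra! hcon
        have := eq_of_le_of_finrank_le (le_sup_left : E ≤ E ⊔ k⟮b⟯) hcon
        exact hbE (this ▸ (le_sup_right : k⟮b⟯ ≤ E ⊔ k⟮b⟯) (mem_adjoin_simple_self k b))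
      omega
    refine (hfin2.union (Set.finite_singleton E)).subset ?_
    rintro F ⟨h1, h2, h3⟩
    by_cases hFE : F ≤ E
    · exact Or.inr (le_antisymm hFE h1)
    left
    obtain ⟨α, hαF, hαE⟩ := SetLike.not_le_iff_exists.1 hFE
    have hle : E⟮α⟯ ≤ extendScalars h1 := by
      rw [adjoin_simple_le_iff]; exact hαF
    have hpos : 0 < (minpoly E α).natDegree := minpoly.natDegree_pos (hint α)
    have hdegN : (minpoly E α).natDegree ≤ N := by
      have hs : (minpoly E α).natDegree ≤ (minpoly k α).natDegree := by
        have := minpoly.dvd_map_of_isScalarTower k E α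
        have h := natDegree_le_of_dvd this (map_ne_zero (minpoly.ne_zero
          (Algebra.IsAlgebraic.isAlgebraic (R := k) α).isIntegral))
        rwa [natDegree_map] at h
      rw [← adjoin.finrank (K := k) (Algebra.IsAlgebraic.isAlgebraic (R := k) α).isIntegral] at hs
      have : k⟮α⟯ ≤ F := by rw [adjoin_simple_le_iff]; exact hαF
      have := finrank_le_of_le_right this
      omega
    obtain ⟨b, hb, hbα⟩ := hB ((minpoly E α).natDegree - 1) α (by omega) hαE
    simp only [Set.mem_iUnion]
    refine ⟨b, ⟨_, Finset.mem_range.2 (by omega), hb⟩, sup_le h1 ?_, h2, h3⟩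
    rw [adjoin_simple_le_iff]
    exact hle hbα

theorem aux_padic (p : ℕ) [Fact p.Prime] (K : Type*) [Field K] [Algebra ℚ_[p] K]
    [FiniteDimensional ℚ_[p] K] (N : ℕ) :
    {F : IntermediateField K (AlgebraicClosure K) |
      FiniteDimensional K F ∧ Module.finrank K F ≤ N}.Finite := by
  have : Algebra.IsAlgebraic ℚ_[p] K := inferInstance
  have halg : Algebra.IsAlgebraic ℚ_[p] (AlgebraicClosure K) := Algebra.IsAlgebraic.trans ℚ_[p] K _
  have : IsAlgClosure ℚ_[p] (AlgebraicClosure K) := ⟨inferInstance, inferInstance⟩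
  have : Normal ℚ_[p] (AlgebraicClosure K) := IsAlgClosure.normal _ _
  have : IsGalois ℚ_[p] (AlgebraicClosure K) := ⟨⟩
  have hf := @aux_finite ℚ_[p] (AlgebraicClosure K) _ _
    (spectralNorm.normedField ℚ_[p] (AlgebraicClosure K))
    (spectralNorm.normedAlgebra ℚ_[p] (AlgebraicClosure K)) _ _
    (fun σ x => (spectralNorm_eq_of_equiv σ x).symm) (Module.finrank ℚ_[p] K * N)
    (Module.finrank ℚ_[p] K * N) ⊥ _ (by omega)
  refine Set.Finite.of_finite_image (f := fun F => F.restrictScalars ℚ_[p]) (hf.subset ?_)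
    (restrictScalars_injective ℚ_[p]).injOn
  rintro _ ⟨F, ⟨h1, h2⟩, rfl⟩
  have h3 : FiniteDimensional ℚ_[p] F := FiniteDimensional.trans ℚ_[p] K F
  refine ⟨bot_le, h3, ?_⟩
  change Module.finrank ℚ_[p] F ≤ _
  rw [← Module.finrank_mul_finrank ℚ_[p] K F]
  gcongr

theorem statement0 (p : ℕ) [Fact p.Prime] (hp : 2 < p) (d : ℕ) (hd : 1 ≤ d)
    (K : Type*) [Field K] [Algebra ℚ_[p] K] [FiniteDimensional ℚ_[p] K] :
    ∃ L : IntermediateField K (AlgebraicClosure K),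
      FiniteDimensional K L ∧ IsGalois K L ∧
      ∀ ρ : (AlgebraicClosure K ≃ₐ[K] AlgebraicClosure K) →* GL (Fin d) ℤ_[p],
        Continuous ρ →
        ∀ g ∈ L.fixingSubgroup,
          (ρ g).val.map (Ideal.Quotient.mk (Ideal.span {(12 * p : ℤ_[p])})) = 1 := by
  have hchar : CharZero K := charZero_of_injective_algebraMap (algebraMap ℚ_[p] K).injective
  set I : Ideal ℤ_[p] := Ideal.span {(12 * p : ℤ_[p])} with hI
  have hI0 : I ≠ ⊥ := by
    have : (p : ℤ_[p]) ≠ 0 := by exact_mod_cast (Fact.out : p.Prime).ne_zero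
    rw [hI, Ne, Ideal.span_singleton_eq_bot]
    exact mul_ne_zero (by norm_num) this
  have hopen : IsOpen (I : Set ℤ_[p]) := by
    obtain ⟨n, hn⟩ := PadicInt.ideal_eq_span_pow_p hI0
    have : (I : Set ℤ_[p]) = Metric.closedBall 0 ((p : ℝ) ^ (-n : ℤ)) := by
      ext x
      rw [mem_closedBall_zero_iff, PadicInt.norm_le_pow_iff_mem_span_pow, hn]
      rfl
    rw [this]
    refine IsUltrametricDist.isOpen_closedBall _ ?_
    have := (Fact.out : p.Prime).pos
    positivity
  have hclosed : IsClosed (I : Set ℤ_[p]) := AddSubgroup.isClosed_of_isOpen I.toAddSubgroup hopen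
  have hfinI : Finite (ℤ_[p] ⧸ I) := AddSubgroup.quotient_finite_of_isOpen I.toAddSubgroup hopen
  set S := {F : IntermediateField K (AlgebraicClosure K) |
      FiniteDimensional K F ∧ Module.finrank K F ≤ Nat.card (GL (Fin d) (ℤ_[p] ⧸ I))} with hS
  have hSf : S.Finite := aux_padic p K _
  have : Finite S := hSf
  have : ∀ F : S, FiniteDimensional K F.1 := fun F => F.2.1
  let L0 : IntermediateField K (AlgebraicClosure K) := ⨆ F : S, F.1
  have : FiniteDimensional K L0 := finiteDimensional_iSup_of_finite
  refine ⟨normalClosure K L0 (AlgebraicClosure K), inferInstance, inferInstance, ?_⟩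
  intro ρ hρ g hg
  let φ := (Matrix.GeneralLinearGroup.map (n := Fin d) (Ideal.Quotient.mk I)).comp ρ
  have hker : ∀ x, x ∈ φ.ker ↔ ∀ i j, (ρ x).val i j - (1 : Matrix (Fin d) (Fin d) ℤ_[p]) i j ∈ I := by
    intro x
    rw [MonoidHom.mem_ker, Units.ext_iff, ← Matrix.ext_iff]
    refine forall_congr' fun i => forall_congr' fun j => ?_
    rw [← Ideal.Quotient.eq]
    have : (Ideal.Quotient.mk I) ((1 : Matrix (Fin d) (Fin d) ℤ_[p]) i j) =
        (1 : Matrix (Fin d) (Fin d) (ℤ_[p] ⧸ I)) i j := by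
      simp only [Matrix.one_apply]; split_ifs <;> simp
    rw [this]
    rfl
  have hkc : IsClosed (φ.ker : Set (AlgebraicClosure K ≃ₐ[K] AlgebraicClosure K)) := by
    have : (φ.ker : Set (AlgebraicClosure K ≃ₐ[K] AlgebraicClosure K)) =
        ⋂ i, ⋂ j, (fun x => (ρ x).val i j - (1 : Matrix (Fin d) (Fin d) ℤ_[p]) i j) ⁻¹' I := by
      ext x
      simpa using hker x
    rw [this]
    refine isClosed_iInter fun i => isClosed_iInter fun j => hclosed.preimage ?_
    have : Continuous fun x => (ρ x).val := Units.continuous_val.comp hρ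
    exact (this.matrix_elem i j).sub continuous_const
  let F := fixedField φ.ker
  have hfix : F.fixingSubgroup = φ.ker := InfiniteGalois.fixingSubgroup_fixedField ⟨φ.ker, hkc⟩
  have hrank : Module.finrank K F = φ.ker.index := by
    rw [finrank_eq_fixingSubgroup_index, hfix]
  have hGLfin : Finite (GL (Fin d) (ℤ_[p] ⧸ I)) := inferInstance
  have hidx : φ.ker.index = Nat.card φ.range := Subgroup.index_ker φ
  have hFS : F ∈ S := by
    refine ⟨FiniteDimensional.of_finrank_pos ?_, ?_⟩
    · rw [hrank, hidx]; exact Nat.card_pos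
    · rw [hrank, hidx]; exact Subgroup.card_le_card_group _
  have hFL : F ≤ normalClosure K L0 (AlgebraicClosure K) :=
    (le_iSup (fun F : S => F.1) ⟨F, hFS⟩).trans (le_normalClosure L0)
  have hgF : g ∈ φ.ker := hfix ▸ fixingSubgroup_le hFL hg
  have := congrArg Units.val (MonoidHom.mem_ker.1 hgF)
  exact this
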